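/- arXiv:1501.02821 — 2 statements merged into one kernel-verified Lean document; each statement's English description precedes it below -/
import Mathlib

section
/- Let n ≥ 3 be an integer and let r be a real number with n-2 ≤ r < n-1. Then there exists a homeomorphism Φ from M_{n,r} onto the unit sphere S^{n-3} = {x ∈ ℝ^{n-2} : ‖x‖ = 1} which is ℤ/2-equivariant: if σ : M_{n,r} → M_{n,r} denotes the involution sending (x_1, …, x_{n-2}) to (c(x_1), …, c(x_{n-2})), where c(a,b) = (a,-b) is reflection across the x-axis, then Φ(σ(P)) = -Φ(P) for every P ∈ M_{n,r}. -/
/-- The point `(a, b)` in the Euclidean plane. -/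
noncomputable def planePt (a b : ℝ) : EuclideanSpace ℝ (Fin 2) :=
  WithLp.toLp 2 (fun j => if j = 0 then a else b)

/-- Reflection across the x-axis: `(a, b) ↦ (a, -b)`. -/
noncomputable def reflX (v : EuclideanSpace ℝ (Fin 2)) : EuclideanSpace ℝ (Fin 2) :=
  planePt (v 0) (-(v 1))

/-- The vertices of the polygon: `x₀ = (0,0)`, `x_{n-1} = (r,0)`, and the variable
vertices `x₁, …, x_{n-2}` given by the tuple `x`. -/
noncomputable def polyVert (n : ℕ) (r : ℝ) (x : Fin (n - 2) → EuclideanSpace ℝ (Fin 2))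
    (i : ℕ) : EuclideanSpace ℝ (Fin 2) :=
  if i = 0 then 0
  else if i = n - 1 then planePt r 0
  else if h : i - 1 < n - 2 then x ⟨i - 1, h⟩ else 0

/-- The moduli space `M_{n,r}` of planar `n`-gons with one side of length `r` and the
other `n-1` sides of length `1`, as a subset of `(ℝ²)^{n-2}`. -/
def MSet (n : ℕ) (r : ℝ) : Set (Fin (n - 2) → EuclideanSpace ℝ (Fin 2)) :=
  { x | ∀ i : ℕ, 1 ≤ i → i ≤ n - 1 →
      dist (polyVert n r x (i - 1)) (polyVert n r x i) = 1 }

/-- Heights of all vertices, as a function of the vector of free heights. -/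
noncomputable def hgt (n : ℕ) (y : EuclideanSpace ℝ (Fin (n - 2))) (i : ℕ) : ℝ :=
  if h : 1 ≤ i ∧ i - 1 < n - 2 then y ⟨i - 1, h.2⟩ else 0

/-- Height increments. -/
noncomputable def inc (n : ℕ) (y : EuclideanSpace ℝ (Fin (n - 2))) (i : ℕ) : ℝ :=
  hgt n y (i + 1) - hgt n y i

/-- The vector of heights of a tuple. -/
noncomputable def yvec (n : ℕ) (x : Fin (n - 2) → EuclideanSpace ℝ (Fin 2)) :
    EuclideanSpace ℝ (Fin (n - 2)) := WithLp.toLp 2 (fun i => x i 1)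

lemma planePt_zero (a b : ℝ) : planePt a b 0 = a := by simp [planePt]
lemma planePt_one (a b : ℝ) : planePt a b 1 = b := by simp [planePt]

lemma hgt_smul (n : ℕ) (t : ℝ) (y : EuclideanSpace ℝ (Fin (n - 2))) (i : ℕ) :
    hgt n (t • y) i = t * hgt n y i := by
  unfold hgt; split_ifs <;> simp

lemma inc_smul (n : ℕ) (t : ℝ) (y : EuclideanSpace ℝ (Fin (n - 2))) (i : ℕ) :
    inc n (t • y) i = t * inc n y i := by
  simp only [inc, hgt_smul]; ring

lemma dist_one_iff (u v : EuclideanSpace ℝ (Fin 2)) :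
    dist u v = 1 ↔ (v 0 - u 0) ^ 2 + (v 1 - u 1) ^ 2 = 1 := by
  rw [EuclideanSpace.dist_eq, Real.sqrt_eq_one, Fin.sum_univ_two, Real.dist_eq, Real.dist_eq,
    sq_abs, sq_abs]
  constructor <;> intro h <;> linarith

lemma mem_iff (n : ℕ) (r : ℝ) (x : Fin (n - 2) → EuclideanSpace ℝ (Fin 2)) :
    x ∈ MSet n r ↔ ∀ j < n - 1,
      (polyVert n r x (j + 1) 0 - polyVert n r x j 0) ^ 2 +
      (polyVert n r x (j + 1) 1 - polyVert n r x j 1) ^ 2 = 1 := by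
  constructor
  · intro h j hj
    have := h (j + 1) (by omega) (by omega)
    rwa [dist_one_iff] at this
  · intro h i h1 h2
    obtain ⟨j, rfl⟩ : ∃ j, i = j + 1 := ⟨i - 1, by omega⟩
    rw [dist_one_iff]
    exact h j (by omega)

lemma vert_one (n : ℕ) (hn : 3 ≤ n) (r : ℝ) (x : Fin (n - 2) → EuclideanSpace ℝ (Fin 2)) (i : ℕ) :
    polyVert n r x i 1 = hgt n (yvec n x) i := by
  unfold polyVert hgt yvec
  by_cases h0 : i = 0
  · simp [h0]
  by_cases h1 : i = n - 1
  · have : ¬ (1 ≤ i ∧ i - 1 < n - 2) := by omega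
    rw [if_neg h0, if_pos h1, dif_neg this, planePt_one]
  by_cases h2 : i - 1 < n - 2
  · have : 1 ≤ i := by omega
    simp [h0, h1, h2, this]
  · simp [h0, h1, h2]

lemma sum_vert (n : ℕ) (hn : 3 ≤ n) (r : ℝ) (x : Fin (n - 2) → EuclideanSpace ℝ (Fin 2)) :
    ∑ j ∈ Finset.range (n - 1), (polyVert n r x (j + 1) 0 - polyVert n r x j 0) = r := by
  rw [Finset.sum_range_sub (fun j => polyVert n r x j 0)]
  have : n - 1 ≠ 0 := by omega
  simp [polyVert, this, planePt_zero]

lemma sum_le_of_one (m : ℕ) (f : ℕ → ℝ) (hf : ∀ j < m, f j ≤ 1) (i : ℕ) (hi : i < m) :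
    ∑ j ∈ Finset.range m, f j ≤ (m : ℝ) - 1 + f i := by
  have h1 := Finset.add_sum_erase (Finset.range m) f (Finset.mem_range.2 hi)
  have h2 : ∑ j ∈ (Finset.range m).erase i, f j ≤ ∑ j ∈ (Finset.range m).erase i, (1 : ℝ) := by
    apply Finset.sum_le_sum
    intro j hj
    exact hf j (Finset.mem_range.1 (Finset.mem_of_mem_erase hj))
  rw [Finset.sum_const, Finset.card_erase_of_mem (Finset.mem_range.2 hi), Finset.card_range,
    nsmul_eq_mul, Nat.cast_sub (by omega)] at h2
  push_cast at h2
  linarith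

lemma step_eq (n : ℕ) (hn : 3 ≤ n) (r : ℝ) (hr1 : (n : ℝ) - 2 ≤ r)
    (x : Fin (n - 2) → EuclideanSpace ℝ (Fin 2)) (hx : x ∈ MSet n r) (j : ℕ) (hj : j < n - 1) :
    inc n (yvec n x) j ^ 2 ≤ 1 ∧ polyVert n r x (j + 1) 0 - polyVert n r x j 0 =
      √(1 - inc n (yvec n x) j ^ 2) := by
  rw [mem_iff] at hx
  have h1 := sum_le_of_one (n - 1) (fun j => polyVert n r x (j + 1) 0 - polyVert n r x j 0)
    (fun j hj => by nlinarith [hx j hj, sq_nonneg (polyVert n r x (j + 1) 1 - polyVert n r x j 1)])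
    j hj
  rw [sum_vert n hn, Nat.cast_sub (by omega)] at h1
  push_cast at h1
  have h2 := hx j hj
  rw [vert_one n hn, vert_one n hn] at h2
  change _ + inc n (yvec n x) j ^ 2 = 1 at h2
  refine ⟨by nlinarith [sq_nonneg (polyVert n r x (j + 1) 0 - polyVert n r x j 0)], ?_⟩
  rw [← h2, add_sub_cancel_right, Real.sqrt_sq (by linarith)]

lemma hgt_eq_zero (n : ℕ) (y : EuclideanSpace ℝ (Fin (n - 2)))
    (h : ∀ j < n - 1, inc n y j = 0) : y = 0 := by
  have h2 : ∀ i ≤ n - 1, hgt n y i = 0 := by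
    intro i
    induction i with
    | zero => intro _; simp [hgt]
    | succ i ih =>
      intro hi
      have := h i (by omega)
      have := ih (by omega)
      simp only [inc] at *
      linarith
  ext ⟨i, hi⟩
  have := h2 (i + 1) (by omega)
  simpa [hgt, hi] using this

lemma sum_sqrt (n : ℕ) (hn : 3 ≤ n) (r : ℝ) (hr1 : (n : ℝ) - 2 ≤ r)
    (x : Fin (n - 2) → EuclideanSpace ℝ (Fin 2)) (hx : x ∈ MSet n r) :
    ∑ j ∈ Finset.range (n - 1), √(1 - inc n (yvec n x) j ^ 2) = r := by
  rw [← sum_vert n hn r x]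
  apply Finset.sum_congr rfl
  intro j hj
  exact ((step_eq n hn r hr1 x hx j (Finset.mem_range.1 hj)).2).symm

lemma yvec_ne (n : ℕ) (hn : 3 ≤ n) (r : ℝ) (hr1 : (n : ℝ) - 2 ≤ r) (hr2 : r < (n : ℝ) - 1)
    (x : Fin (n - 2) → EuclideanSpace ℝ (Fin 2)) (hx : x ∈ MSet n r) : yvec n x ≠ 0 := by
  intro h0
  have := sum_sqrt n hn r hr1 x hx
  rw [h0] at this
  simp [inc, hgt] at this
  rw [Nat.cast_sub (by omega)] at this
  push_cast at this
  linarith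

/-- A tuple is determined by its heights. -/
lemma yvec_inj (n : ℕ) (hn : 3 ≤ n) (r : ℝ) (hr1 : (n : ℝ) - 2 ≤ r)
    (x x' : Fin (n - 2) → EuclideanSpace ℝ (Fin 2)) (hx : x ∈ MSet n r) (hx' : x' ∈ MSet n r)
    (h : yvec n x = yvec n x') : x = x' := by
  have h2 : ∀ i ≤ n - 1, polyVert n r x i 0 = polyVert n r x' i 0 := by
    intro i
    induction i with
    | zero => intro _; simp [polyVert]
    | succ i ih =>
      intro hi
      have a1 := (step_eq n hn r hr1 x hx i (by omega)).2
      have a2 := (step_eq n hn r hr1 x' hx' i (by omega)).2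
      have a3 := ih (by omega)
      rw [h] at a1
      linarith
  funext ⟨i, hi⟩
  ext k
  fin_cases k
  · have := h2 (i + 1) (by omega)
    have h3 : i + 1 ≠ n - 1 := by omega
    simpa [polyVert, hi, h3] using this
  · have := congrArg (fun y => y ⟨i, hi⟩) h
    simpa [yvec] using this

lemma scale_le (n : ℕ) (hn : 3 ≤ n) (r : ℝ) (hr1 : (n : ℝ) - 2 ≤ r) (hr2 : r < (n : ℝ) - 1)
    (x x' : Fin (n - 2) → EuclideanSpace ℝ (Fin 2)) (hx : x ∈ MSet n r) (hx' : x' ∈ MSet n r)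
    (t : ℝ) (ht : 0 < t) (h : yvec n x' = t • yvec n x) : 1 ≤ t := by
  by_contra! hlt
  have s1 := sum_sqrt n hn r hr1 x hx
  have s2 := sum_sqrt n hn r hr1 x' hx'
  rw [h] at s2
  have hne : ∃ j < n - 1, inc n (yvec n x) j ≠ 0 := by
    by_contra! hc
    exact yvec_ne n hn r hr1 hr2 x hx (hgt_eq_zero n _ hc)
  have ht2 : t ^ 2 < 1 := by nlinarith
  have : ∑ j ∈ Finset.range (n - 1), √(1 - inc n (yvec n x) j ^ 2) <
      ∑ j ∈ Finset.range (n - 1), √(1 - inc n (t • yvec n x) j ^ 2) := by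
    apply Finset.sum_lt_sum
    · intro j hj
      apply Real.sqrt_le_sqrt
      rw [inc_smul, mul_pow]
      nlinarith [sq_nonneg (inc n (yvec n x) j)]
    · obtain ⟨j, hj, hj2⟩ := hne
      refine ⟨j, Finset.mem_range.2 hj, ?_⟩
      have := (step_eq n hn r hr1 x hx j hj).1
      apply Real.sqrt_lt_sqrt (by linarith)
      rw [inc_smul, mul_pow]
      have : 0 < inc n (yvec n x) j ^ 2 := by positivity
      nlinarith
  linarith

/-- Existence of a polygon with heights on a given ray. -/
lemma exists_ray (n : ℕ) (hn : 3 ≤ n) (r : ℝ) (hr1 : (n : ℝ) - 2 ≤ r) (hr2 : r < (n : ℝ) - 1)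
    (v : EuclideanSpace ℝ (Fin (n - 2))) (hv : v ≠ 0) :
    ∃ t : ℝ, 0 < t ∧ ∃ x ∈ MSet n r, yvec n x = t • v := by
  have hne : ∃ j < n - 1, inc n v j ≠ 0 := by
    by_contra! hc
    exact hv (hgt_eq_zero n _ hc)
  obtain ⟨i, hi, hmax⟩ := Finset.exists_max_image (Finset.range (n - 1)) (fun j => |inc n v j|)
    ⟨0, Finset.mem_range.2 (by omega)⟩
  rw [Finset.mem_range] at hi
  obtain ⟨j0, hj0, hj0'⟩ := hne
  have hA : 0 < |inc n v i| :=
    lt_of_lt_of_le (abs_pos.2 hj0') (hmax j0 (Finset.mem_range.2 hj0))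
  set A := |inc n v i| with hAdef
  let g : ℝ → ℝ := fun t => ∑ j ∈ Finset.range (n - 1), √(1 - (t * inc n v j) ^ 2)
  have hg : Continuous g := by fun_prop
  have hcast : ((n - 1 : ℕ) : ℝ) = (n : ℝ) - 1 := by rw [Nat.cast_sub (by omega)]; simp
  have g0 : g 0 = (n : ℝ) - 1 := by simp [g, hcast]
  have gA : g A⁻¹ ≤ r := by
    have := sum_le_of_one (n - 1) (fun j => √(1 - (A⁻¹ * inc n v j) ^ 2)) (fun j _ => by
      exact Real.sqrt_le_iff.2 ⟨zero_le_one, by nlinarith [sq_nonneg (A⁻¹ * inc n v j)]⟩) i hi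
    have e : (A⁻¹ * inc n v i) ^ 2 = 1 := by
      rw [mul_pow, ← sq_abs (inc n v i), ← hAdef, ← mul_pow, inv_mul_cancel₀ hA.ne', one_pow]
    simp only [e, hcast] at this
    simp at this
    change g A⁻¹ ≤ _ at this
    linarith
  obtain ⟨t, ⟨ht0, htA⟩, htr⟩ := intermediate_value_Icc' (inv_pos.2 hA).le hg.continuousOn
    (show r ∈ Set.Icc (g A⁻¹) (g 0) from ⟨gA, by linarith⟩)
  have htpos : 0 < t := by
    rcases ht0.lt_or_eq with h | h
    · exact h
    · rw [← h] at htr; linarith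
  have hle : ∀ j < n - 1, (t * inc n v j) ^ 2 ≤ 1 := by
    intro j hj
    rw [sq_le_one_iff_abs_le_one, abs_mul, abs_of_pos htpos]
    calc t * |inc n v j| ≤ A⁻¹ * A := by
          gcongr
          exact hmax j (Finset.mem_range.2 hj)
      _ = 1 := inv_mul_cancel₀ hA.ne'
  let X : ℕ → ℝ := fun i => ∑ j ∈ Finset.range i, √(1 - (t * inc n v j) ^ 2)
  let x : Fin (n - 2) → EuclideanSpace ℝ (Fin 2) := fun i => planePt (X (i + 1)) (t * v i)
  have hy : yvec n x = t • v := by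
    ext i
    simp [yvec, x, planePt_one]
  have hX : ∀ i ≤ n - 1, polyVert n r x i 0 = X i := by
    intro i hi
    unfold polyVert
    by_cases h0 : i = 0
    · simp [h0, X]
    by_cases h1 : i = n - 1
    · rw [if_neg h0, if_pos h1, planePt_zero, h1]
      exact htr.symm
    have h2 : i - 1 < n - 2 := by omega
    rw [if_neg h0, if_neg h1, dif_pos h2]
    simp only [x, planePt_zero]
    rw [Nat.sub_add_cancel (by omega)]
  refine ⟨t, htpos, x, ?_, hy⟩
  rw [mem_iff]
  intro j hj
  rw [hX _ (by omega), hX _ (by omega), vert_one n hn, vert_one n hn, hy]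
  change _ + (inc n (t • v) j) ^ 2 = 1
  rw [inc_smul]
  have : X (j + 1) - X j = √(1 - (t * inc n v j) ^ 2) := by
    simp only [X, Finset.sum_range_succ]; ring
  rw [this, Real.sq_sqrt (by linarith [hle j hj])]
  ring

lemma cont_vert (n : ℕ) (r : ℝ) (i : ℕ) : Continuous (fun x => polyVert n r x i) := by
  unfold polyVert
  split_ifs <;> fun_prop

lemma isCompact_MSet (n : ℕ) (r : ℝ) : IsCompact (MSet n r) := by
  have hcl : IsClosed (MSet n r) := by
    simp only [MSet, Set.setOf_forall]
    refine isClosed_iInter fun i => isClosed_iInter fun _ => isClosed_iInter fun _ => ?_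
    exact isClosed_eq ((cont_vert n r _).dist (cont_vert n r _)) continuous_const
  refine (isCompact_univ_pi (fun _ : Fin (n - 2) =>
    isCompact_closedBall (0 : EuclideanSpace ℝ (Fin 2)) (n : ℝ))).of_isClosed_subset hcl ?_
  intro x hx
  have h : ∀ i ≤ n - 1, dist (polyVert n r x i) 0 ≤ i := by
    intro i
    induction i with
    | zero => intro _; simp [polyVert]
    | succ i ih =>
      intro hi
      have a := ih (by omega)
      have b := hx (i + 1) (by omega) hi
      have c := dist_triangle_left (polyVert n r x (i + 1)) 0 (polyVert n r x i)
      simp only [Nat.add_sub_cancel] at b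
      push_cast
      linarith
  rintro ⟨i, hi⟩ -
  have := h (i + 1) (by omega)
  have h3 : i + 1 ≠ n - 1 := by omega
  have h4 : ((i + 1 : ℕ) : ℝ) ≤ n := by exact_mod_cast (by omega)
  rw [Metric.mem_closedBall]
  refine le_trans ?_ (this.trans h4)
  simp [polyVert, hi, h3]

lemma refl_mem (n : ℕ) (hn : 3 ≤ n) (r : ℝ) (x : Fin (n - 2) → EuclideanSpace ℝ (Fin 2))
    (hx : x ∈ MSet n r) : (fun i => reflX (x i)) ∈ MSet n r := by
  have h : ∀ i, polyVert n r (fun i => reflX (x i)) i = reflX (polyVert n r x i) := by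
    intro i
    unfold polyVert
    split_ifs <;> ext k <;> fin_cases k <;> simp [reflX, planePt]
  rw [mem_iff] at *
  intro j hj
  rw [h, h, ← hx j hj]
  simp only [reflX, planePt_zero, planePt_one]
  ring

lemma yvec_refl (n : ℕ) (x : Fin (n - 2) → EuclideanSpace ℝ (Fin 2)) :
    yvec n (fun i => reflX (x i)) = - yvec n x := by
  ext i
  simp [yvec, reflX, planePt_one]

lemma cont_yvec (n : ℕ) : Continuous (yvec n) := by
  unfold yvec
  fun_prop


/-- For `n ≥ 3` and `n-2 ≤ r < n-1`, coordinatewise reflection across the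
x-axis is an involution `σ` of `M_{n,r}`, and there is a homeomorphism
`Φ : M_{n,r} ≃ₜ S^{n-3}` which is `ℤ/2`-equivariant: `Φ(σ P) = -Φ(P)`. -/
theorem polygon_space_equivariant_homeo_sphere
    (n : ℕ) (hn : 3 ≤ n) (r : ℝ) (hr1 : (n : ℝ) - 2 ≤ r) (hr2 : r < (n : ℝ) - 1) :
    (∀ x ∈ MSet n r, (fun i => reflX (x i)) ∈ MSet n r) ∧
    ∃ Φ : (MSet n r) ≃ₜ (Metric.sphere (0 : EuclideanSpace ℝ (Fin (n - 2))) 1),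
      ∀ (x : Fin (n - 2) → EuclideanSpace ℝ (Fin 2)) (hx : x ∈ MSet n r)
        (hσ : (fun i => reflX (x i)) ∈ MSet n r),
        ((Φ ⟨fun i => reflX (x i), hσ⟩ : EuclideanSpace ℝ (Fin (n - 2))))
          = -((Φ ⟨x, hx⟩ : EuclideanSpace ℝ (Fin (n - 2)))) := by
  refine ⟨refl_mem n hn r, ?_⟩
  haveI : CompactSpace (MSet n r) := isCompact_iff_compactSpace.1 (isCompact_MSet n r)
  have hne : ∀ x : MSet n r, ‖yvec n x.1‖ ≠ 0 := fun x =>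
    norm_ne_zero_iff.2 (yvec_ne n hn r hr1 hr2 x.1 x.2)
  let F : MSet n r → Metric.sphere (0 : EuclideanSpace ℝ (Fin (n - 2))) 1 := fun x =>
    ⟨‖yvec n x.1‖⁻¹ • yvec n x.1, by
      rw [mem_sphere_zero_iff_norm, norm_smul, norm_inv, norm_norm, inv_mul_cancel₀ (hne x)]⟩
  have hF : Continuous F := by
    apply Continuous.subtype_mk
    have h1 : Continuous (fun x : MSet n r => yvec n x.1) :=
      (cont_yvec n).comp continuous_subtype_val
    exact (h1.norm.inv₀ hne).smul h1
  have hinj : Function.Injective F := by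
    intro x x' h
    have h' : ‖yvec n x.1‖⁻¹ • yvec n x.1 = ‖yvec n x'.1‖⁻¹ • yvec n x'.1 := congrArg Subtype.val h
    have key : ∀ a b : MSet n r,
        ‖yvec n a.1‖⁻¹ • yvec n a.1 = ‖yvec n b.1‖⁻¹ • yvec n b.1 →
        ‖yvec n a.1‖ ≤ ‖yvec n b.1‖ := by
      intro a b hab
      have pa : 0 < ‖yvec n a.1‖ := (norm_nonneg _).lt_of_ne (hne a).symm
      have pb : 0 < ‖yvec n b.1‖ := (norm_nonneg _).lt_of_ne (hne b).symm
      have := scale_le n hn r hr1 hr2 a.1 b.1 a.2 b.2 (‖yvec n b.1‖ * ‖yvec n a.1‖⁻¹)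
        (by positivity) (by rw [mul_smul, hab, smul_inv_smul₀ (hne b)])
      rwa [← div_eq_mul_inv, one_le_div pa] at this
    have e := le_antisymm (key x x' h') (key x' x h'.symm)
    rw [e] at h'
    apply Subtype.ext
    exact yvec_inj n hn r hr1 _ _ x.2 x'.2 (smul_right_injective _ (inv_ne_zero (hne x')) h')
  have hsurj : Function.Surjective F := by
    rintro ⟨v, hv⟩
    rw [mem_sphere_zero_iff_norm] at hv
    obtain ⟨t, ht, x, hx, hxy⟩ := exists_ray n hn r hr1 hr2 v
      (by rintro rfl; simp at hv)
    refine ⟨⟨x, hx⟩, Subtype.ext ?_⟩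
    change ‖yvec n x‖⁻¹ • yvec n x = v
    rw [hxy, norm_smul, hv, Real.norm_of_nonneg ht.le, mul_one, inv_smul_smul₀ ht.ne']
  refine ⟨Continuous.homeoOfEquivCompactToT2 (f := Equiv.ofBijective F ⟨hinj, hsurj⟩) hF, ?_⟩
  intro x hx hσ
  change ‖yvec n (fun i => reflX (x i))‖⁻¹ • yvec n (fun i => reflX (x i)) =
    -(‖yvec n x‖⁻¹ • yvec n x)
  rw [yvec_refl, norm_neg, smul_neg]
end

section
/- Let n ≥ 3 be an integer and let r be a real number with n-2 ≤ r < n-1. Then the involution σ on M_{n,r} given by coordinatewise reflection across the x-axis has no fixed points; equivalently, there is no tuple (x_1, …, x_{n-2}) ∈ M_{n,r} all of whose points lie on the x-axis (i.e., have second coordinate zero). -/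
theorem polyVert_snd (n : ℕ) (r : ℝ) (x : Fin (n - 2) → EuclideanSpace ℝ (Fin 2))
    (h : ∀ i : Fin (n - 2), x i 1 = 0) (i : ℕ) : polyVert n r x i 1 = 0 := by
  unfold polyVert
  split_ifs
  · simp
  · simp [planePt]
  · exact h _
  · simp

theorem no_collinear (n : ℕ) (hn : 3 ≤ n) (r : ℝ) (hr1 : (n : ℝ) - 2 ≤ r)
    (hr2 : r < (n : ℝ) - 1) (x : Fin (n - 2) → EuclideanSpace ℝ (Fin 2))
    (hx : x ∈ MSet n r) (h : ∀ i : Fin (n - 2), x i 1 = 0) : False := by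
  have key : ∀ i : ℕ, i ≤ n - 1 → ∃ k : ℤ, polyVert n r x i 0 = (i : ℝ) - 2 * (k : ℝ) := by
    intro i
    induction i with
    | zero => intro _; exact ⟨0, by simp [polyVert]⟩
    | succ i ih =>
      intro hi
      obtain ⟨k, hk⟩ := ih (by omega)
      have hd := hx (i + 1) (by omega) hi
      rw [EuclideanSpace.dist_eq, Real.sqrt_eq_one, Fin.sum_univ_two, Real.dist_eq, Real.dist_eq,
        sq_abs, sq_abs, Nat.add_sub_cancel, polyVert_snd n r x h, polyVert_snd n r x h, hk] at hd
      have h2 : (polyVert n r x (i + 1) 0 - ((i : ℝ) - 2 * k) - 1) *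
          (polyVert n r x (i + 1) 0 - ((i : ℝ) - 2 * k) + 1) = 0 := by
        linear_combination hd
      rcases mul_eq_zero.mp h2 with h3 | h3
      · exact ⟨k, by push_cast; linarith⟩
      · exact ⟨k + 1, by push_cast; linarith⟩
  obtain ⟨k, hk⟩ := key (n - 1) le_rfl
  have he : polyVert n r x (n - 1) 0 = r := by
    have : n - 1 ≠ 0 := by omega
    simp [polyVert, this, planePt]
  rw [he, Nat.cast_sub (by omega), Nat.cast_one] at hk
  have h1 : (0 : ℝ) < 2 * (k : ℝ) := by linarith
  have h2 : 2 * (k : ℝ) ≤ 1 := by linarith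
  have h1' : 0 < 2 * k := by exact_mod_cast h1
  have h2' : 2 * k ≤ 1 := by exact_mod_cast h2
  omega

/-- For `n ≥ 3` and `n-2 ≤ r < n-1`, the involution `σ` on `M_{n,r}`
(coordinatewise reflection across the x-axis) has no fixed points; equivalently there is
no polygon in `M_{n,r}` all of whose vertices lie on the x-axis. -/
theorem reflection_involution_has_no_fixed_points
    (n : ℕ) (hn : 3 ≤ n) (r : ℝ) (hr1 : (n : ℝ) - 2 ≤ r) (hr2 : r < (n : ℝ) - 1) :
    (∀ x ∈ MSet n r, (fun i => reflX (x i)) ≠ x) ∧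
    ¬ ∃ x ∈ MSet n r, ∀ i : Fin (n - 2), x i 1 = 0 := by
  refine ⟨fun x hx hfix => no_collinear n hn r hr1 hr2 x hx fun i => ?_,
    fun ⟨x, hx, h⟩ => no_collinear n hn r hr1 hr2 x hx h⟩
  have h := congrArg (fun v : EuclideanSpace ℝ (Fin 2) => v 1) (congrFun hfix i)
  simp [reflX, planePt] at h
  linarith
end
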